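/- Let b ∈ C¹_♯(Y_d)^d with flow X, and let μ be a probability measure on Y_d. Then μ is invariant for the flow X if and only if the following divergence-curl identity holds: for every C¹ function ψ : ℝ^d → ℝ whose gradient ∇ψ is ℤ^d-periodic and continuous, ∫_{Y_d} b(y)·∇ψ(y) dμ(y) = (∫_{Y_d} b(y) dμ(y)) · (∫_{Y_d} ∇ψ(y) dy). -/

import Mathlib

open MeasureTheory Filter Matrix

noncomputable section

/-- A function on `ℝ^d` is `ℤ^d`-periodic. -/
def ZdPeriodic {d : ℕ} {E : Type*} (f : (Fin d → ℝ) → E) : Prop :=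
  ∀ (κ : Fin d → ℤ) (x : Fin d → ℝ), f (x + fun i => (κ i : ℝ)) = f x

/-- The unit cube `[0,1)^d`, a fundamental domain for the torus `Y_d = ℝ^d/ℤ^d`. -/
def unitCube (d : ℕ) : Set (Fin d → ℝ) := {x | ∀ i, x i ∈ Set.Ico (0 : ℝ) 1}

/-- `X` is the global flow of the vector field `b`: `∂X/∂t(t,x) = b(X(t,x))`, `X(0,x) = x`. -/
def IsFlowOf {d : ℕ} (b : (Fin d → ℝ) → (Fin d → ℝ))
    (X : ℝ → (Fin d → ℝ) → (Fin d → ℝ)) : Prop :=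
  ∀ x : Fin d → ℝ, X 0 x = x ∧ ∀ t : ℝ, HasDerivAt (fun s => X s x) (b (X t x)) t

/-- A measure `μ` on the torus `Y_d` (identified with a measure on `ℝ^d` carried by the unit
cube) is invariant for the flow `X`: `∫ ψ(X(t,y)) dμ = ∫ ψ dμ` for all `t` and all continuous
`ℤ^d`-periodic `ψ`. -/
def FlowInvariant {d : ℕ} (X : ℝ → (Fin d → ℝ) → (Fin d → ℝ))
    (μ : Measure (Fin d → ℝ)) : Prop :=
  ∀ (t : ℝ) (ψ : (Fin d → ℝ) → ℝ), Continuous ψ → ZdPeriodic ψ →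
    ∫ y, ψ (X t y) ∂μ = ∫ y, ψ y ∂μ

/-- Herman's rotation set `C_b = {∫ b dμ : μ invariant probability measure for the flow}`. -/
def rotationSet {d : ℕ} (b : (Fin d → ℝ) → (Fin d → ℝ))
    (X : ℝ → (Fin d → ℝ) → (Fin d → ℝ)) : Set (Fin d → ℝ) :=
  {ζ | ∃ μ : Measure (Fin d → ℝ), IsProbabilityMeasure μ ∧ μ (unitCube d)ᶜ = 0 ∧
        FlowInvariant X μ ∧ ζ = ∫ y, b y ∂μ}

/-- The gradient of a scalar function on `ℝ^d`. -/
def grad {d : ℕ} (ψ : (Fin d → ℝ) → ℝ) (y : Fin d → ℝ) : Fin d → ℝ :=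
  fun i => fderiv ℝ ψ y (Pi.single i 1)

section Periodic

variable {d : ℕ} {E : Type*}

lemma ZdPeriodic.comp {F : Type*} {f : (Fin d → ℝ) → E} (hf : ZdPeriodic f) (g : E → F) :
    ZdPeriodic (fun x => g (f x)) := fun κ x => congrArg g (hf κ x)

/-- Every point can be translated into `[0,1]^d` by an integer vector. -/
lemma exists_add_int_mem_Icc (x : Fin d → ℝ) :
    ∃ κ : Fin d → ℤ, (x + fun i => (κ i : ℝ)) ∈ Set.Icc (0 : Fin d → ℝ) 1 := by
  refine ⟨fun i => -⌊x i⌋, ⟨fun i => ?_, fun i => ?_⟩⟩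
  · have := Int.floor_le (x i)
    simp only [Pi.add_apply, Pi.zero_apply, Int.cast_neg]
    linarith
  · have := Int.lt_floor_add_one (x i)
    simp only [Pi.add_apply, Pi.one_apply, Int.cast_neg]
    linarith

lemma ZdPeriodic.exists_norm_le [NormedAddCommGroup E] {f : (Fin d → ℝ) → E}
    (hf : ZdPeriodic f) (hc : Continuous f) : ∃ C : ℝ, 0 ≤ C ∧ ∀ x, ‖f x‖ ≤ C := by
  obtain ⟨C, hC⟩ := (isCompact_Icc (a := (0 : Fin d → ℝ)) (b := 1)).exists_bound_of_continuousOn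
    hc.continuousOn
  refine ⟨max C 0, le_max_right _ _, fun x => ?_⟩
  obtain ⟨κ, hκ⟩ := exists_add_int_mem_Icc x
  rw [← hf κ x]
  exact (hC _ hκ).trans (le_max_left _ _)

lemma ZdPeriodic.uniformContinuous [NormedAddCommGroup E] {f : (Fin d → ℝ) → E}
    (hf : ZdPeriodic f) (hc : Continuous f) : UniformContinuous f := by
  rw [Metric.uniformContinuous_iff]
  intro ε hε
  have h := (isCompact_Icc (a := (0 : Fin d → ℝ)) (b := 1)).uniformContinuousAt_of_continuousAt
    f (fun a _ => hc.continuousAt) (Metric.dist_mem_uniformity hε)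
  obtain ⟨δ, hδ, H⟩ := Metric.mem_uniformity_dist.1 h
  refine ⟨δ, hδ, fun {a b} hab => ?_⟩
  obtain ⟨κ, hκ⟩ := exists_add_int_mem_Icc a
  have := H (a := a + fun i => (κ i : ℝ)) (b := b + fun i => (κ i : ℝ)) (by simpa using hab) hκ
  simpa [hf κ] using this

lemma ZdPeriodic.integrable [NormedAddCommGroup E] {f : (Fin d → ℝ) → E}
    (hf : ZdPeriodic f) (hc : Continuous f) (μ : Measure (Fin d → ℝ)) [IsFiniteMeasure μ] :
    Integrable f μ := by
  obtain ⟨C, -, hC⟩ := hf.exists_norm_le hc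
  exact Integrable.of_bound hc.aestronglyMeasurable C (Eventually.of_forall hC)

lemma ZdPeriodic.fderiv [NormedAddCommGroup E] [NormedSpace ℝ E] {f : (Fin d → ℝ) → E}
    (hf : ZdPeriodic f) : ZdPeriodic (fderiv ℝ f) := by
  intro κ x
  rw [← fderiv_comp_add_right]
  congr 1
  exact funext (hf κ)

lemma ZdPeriodic.fderiv_apply [NormedAddCommGroup E] [NormedSpace ℝ E] {f : (Fin d → ℝ) → E}
    (hf : ZdPeriodic f) {b : (Fin d → ℝ) → (Fin d → ℝ)} (hb : ZdPeriodic b) :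
    ZdPeriodic (fun x => _root_.fderiv ℝ f x (b x)) := fun κ x => by
  simp only [hf.fderiv κ x, hb κ x]

lemma ZdPeriodic.exists_lipschitzWith [NormedAddCommGroup E] [NormedSpace ℝ E]
    {f : (Fin d → ℝ) → E} (hf : ZdPeriodic f) (hc : ContDiff ℝ 1 f) :
    ∃ K : NNReal, LipschitzWith K f := by
  obtain ⟨C, hC0, hC⟩ := hf.fderiv.exists_norm_le (hc.continuous_fderiv one_ne_zero)
  exact ⟨⟨C, hC0⟩, lipschitzWith_of_nnnorm_fderiv_le (hc.differentiable one_ne_zero) hC⟩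

end Periodic

section Flow

variable {d : ℕ} {b : (Fin d → ℝ) → (Fin d → ℝ)} {X : ℝ → (Fin d → ℝ) → (Fin d → ℝ)}

lemma IsFlowOf.zero (hX : IsFlowOf b X) (x : Fin d → ℝ) : X 0 x = x := (hX x).1

lemma IsFlowOf.hasDerivAt (hX : IsFlowOf b X) (x : Fin d → ℝ) (t : ℝ) :
    HasDerivAt (fun s => X s x) (b (X t x)) t := (hX x).2 t

lemma IsFlowOf.eq_of_hasDerivAt {K : NNReal} (hb : LipschitzWith K b) (hX : IsFlowOf b X)
    {x : Fin d → ℝ} {f : ℝ → Fin d → ℝ} (hf : ∀ t, HasDerivAt f (b (f t)) t) (h0 : f 0 = x)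
    (t : ℝ) : f t = X t x :=
  congrFun (ODE_solution_unique_univ (v := fun _ => b) (s := fun _ => Set.univ) (t₀ := 0)
    (fun _ => hb.lipschitzOnWith) (fun t => ⟨hf t, trivial⟩)
    (fun t => ⟨hX.hasDerivAt x t, trivial⟩) (by rw [h0, hX.zero])) t

lemma IsFlowOf.add {K : NNReal} (hb : LipschitzWith K b) (hX : IsFlowOf b X) (t s : ℝ)
    (x : Fin d → ℝ) : X (t + s) x = X t (X s x) :=
  hX.eq_of_hasDerivAt hb (f := fun r => X (r + s) x)
    (fun r => (hX.hasDerivAt x (r + s)).comp_add_const r s) (by simp) t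

lemma IsFlowOf.add_int {K : NNReal} (hb : LipschitzWith K b) (hbper : ZdPeriodic b)
    (hX : IsFlowOf b X) (t : ℝ) (κ : Fin d → ℤ) (x : Fin d → ℝ) :
    X t (x + fun i => (κ i : ℝ)) = X t x + fun i => (κ i : ℝ) := by
  refine (hX.eq_of_hasDerivAt hb (f := fun r => X r x + fun i => (κ i : ℝ)) (fun r => ?_) ?_ t).symm
  · rw [hbper κ]
    exact (hX.hasDerivAt x r).add_const _
  · simp [hX.zero]

lemma ZdPeriodic.comp_flow {E : Type*} {f : (Fin d → ℝ) → E} (hf : ZdPeriodic f) {K : NNReal}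
    (hb : LipschitzWith K b) (hbper : ZdPeriodic b) (hX : IsFlowOf b X) (t : ℝ) :
    ZdPeriodic (fun x => f (X t x)) := fun κ x => by
  simp only [hX.add_int hb hbper, hf κ]

lemma IsFlowOf.lipschitzWith_of_nonneg {K : NNReal} (hb : LipschitzWith K b) (hX : IsFlowOf b X)
    {t : ℝ} (ht : 0 ≤ t) : LipschitzWith (Real.exp (K * t)).toNNReal (X t) := by
  refine LipschitzWith.of_dist_le_mul fun x y => ?_
  have := dist_le_of_trajectories_ODE (v := fun _ => b) (K := K) (f := fun s => X s x)
    (g := fun s => X s y) (a := 0) (b := t) (δ := dist x y) (fun _ => hb)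
    (fun s _ => (hX.hasDerivAt x s).continuousAt.continuousWithinAt)
    (fun s _ => (hX.hasDerivAt x s).hasDerivWithinAt)
    (fun s _ => (hX.hasDerivAt y s).continuousAt.continuousWithinAt)
    (fun s _ => (hX.hasDerivAt y s).hasDerivWithinAt) (by simp [hX.zero]) t ⟨ht, le_rfl⟩
  rw [Real.coe_toNNReal _ (Real.exp_pos _).le, mul_comm]
  simpa using this

lemma IsFlowOf.reverse (hX : IsFlowOf b X) : IsFlowOf (fun x => -b x) (fun t => X (-t)) := by
  intro x
  refine ⟨by simp [hX.zero], fun t => ?_⟩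
  have h := (hX.hasDerivAt x (-t)).scomp t (hasDerivAt_neg t)
  rwa [neg_one_smul] at h

lemma IsFlowOf.exists_lipschitzWith {K : NNReal} (hb : LipschitzWith K b) (hX : IsFlowOf b X)
    (t : ℝ) : ∃ L : NNReal, LipschitzWith L (X t) := by
  rcases le_total 0 t with ht | ht
  · exact ⟨_, hX.lipschitzWith_of_nonneg hb ht⟩
  · have := hX.reverse.lipschitzWith_of_nonneg hb.neg (neg_nonneg.2 ht)
    simp only [neg_neg] at this
    exact ⟨_, this⟩

lemma IsFlowOf.continuous {K : NNReal} (hb : LipschitzWith K b) (hX : IsFlowOf b X)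
    (t : ℝ) : Continuous (X t) :=
  (hX.exists_lipschitzWith hb t).choose_spec.continuous

/-- The flow deviates from a straight line of slope `b x` at most linearly. -/
lemma IsFlowOf.norm_sub_le {K : NNReal} (hb : LipschitzWith K b) (hX : IsFlowOf b X)
    {B δ : ℝ} (hB : ∀ x, ‖b x‖ ≤ B) {x w : Fin d → ℝ} (hw : dist w x ≤ δ) (h : ℝ) :
    ‖w + h • b x - X h w‖ ≤ K * (δ + B * |h|) * |h| := by
  have hdrift : ∀ s, ‖X s w - w‖ ≤ B * |s| := fun s => by
    have := Convex.norm_image_sub_le_of_norm_hasDerivWithin_le (s := Set.univ) (x := 0) (y := s)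
      (fun r _ => (hX.hasDerivAt w r).hasDerivWithinAt) (fun r _ => hB _) convex_univ
      trivial trivial
    simpa [hX.zero] using this
  have hB0 : 0 ≤ B := (norm_nonneg _).trans (hB x)
  have hder : ∀ s ∈ Set.uIcc 0 h, HasDerivWithinAt (fun s => w + s • b x - X s w)
      (b x - b (X s w)) (Set.uIcc 0 h) s := fun s _ => by
    have h1 : HasDerivAt (fun s : ℝ => w + s • b x) (b x) s := by
      simpa using ((hasDerivAt_id s).smul_const (b x)).const_add w
    exact (h1.sub (hX.hasDerivAt w s)).hasDerivWithinAt
  have hbd : ∀ s ∈ Set.uIcc 0 h, ‖b x - b (X s w)‖ ≤ K * (δ + B * |h|) := fun s hs => by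
    rw [← dist_eq_norm]
    refine (hb.dist_le_mul _ _).trans (mul_le_mul_of_nonneg_left ?_ K.2)
    have hs' : |s| ≤ |h| := by simpa using Set.abs_sub_left_of_mem_uIcc hs
    calc dist x (X s w) ≤ dist x w + dist w (X s w) := dist_triangle _ _ _
      _ ≤ δ + B * |h| := by
        rw [dist_comm x w, dist_comm w (X s w), dist_eq_norm (X s w)]
        gcongr
        exact (hdrift s).trans (by gcongr)
  have := Convex.norm_image_sub_le_of_norm_hasDerivWithin_le hder hbd (convex_uIcc 0 h)
    Set.left_mem_uIcc Set.right_mem_uIcc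
  simpa [hX.zero] using this

end Flow

section MeanGradient

variable {d : ℕ}

lemma unitCube_ae_eq_Icc : unitCube d =ᵐ[volume] Set.Icc (0 : Fin d → ℝ) 1 := by
  have : unitCube d = Set.univ.pi fun _ => Set.Ico (0 : ℝ) 1 := by
    ext x
    simp [unitCube]
  rw [this]
  exact Measure.univ_pi_Ico_ae_eq_Icc

lemma volume_unitCube : volume (unitCube d) = 1 := by
  rw [measure_congr unitCube_ae_eq_Icc, Real.volume_Icc_pi]
  simp

lemma ZdPeriodic.setIntegral_fderiv_single_eq_zero {φ : (Fin d → ℝ) → ℝ} (hper : ZdPeriodic φ)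
    (hφ : ContDiff ℝ 1 φ) (i : Fin d) :
    ∫ y in unitCube d, _root_.fderiv ℝ φ y (Pi.single i 1) = 0 := by
  rw [setIntegral_congr_set unitCube_ae_eq_Icc]
  obtain _ | n := d
  · exact i.elim0
  have hcont : Continuous fun y => _root_.fderiv ℝ φ y (Pi.single i 1) :=
    (hφ.continuous_fderiv one_ne_zero).clm_apply continuous_const
  have hsum : ∀ y, ∑ j, ((Pi.single i 1 : Fin (n + 1) → ℝ) j • _root_.fderiv ℝ φ y)
      (Pi.single j 1) = _root_.fderiv ℝ φ y (Pi.single i 1) := fun y => by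
    rw [Finset.sum_eq_single i] <;> simp +contextual
  have := integral_divergence_of_hasFDerivAt_off_countable' (0 : Fin (n + 1) → ℝ) 1
    zero_le_one (fun j y => (Pi.single i 1 : Fin (n + 1) → ℝ) j • φ y)
    (fun j y => (Pi.single i 1 : Fin (n + 1) → ℝ) j • _root_.fderiv ℝ φ y) ∅
    Set.countable_empty (fun j => (hφ.continuous.const_smul
      ((Pi.single i 1 : Fin (n + 1) → ℝ) j)).continuousOn)
    (fun y _ j => ((hφ.differentiable one_ne_zero) y).hasFDerivAt.const_smul
      ((Pi.single i 1 : Fin (n + 1) → ℝ) j))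
    (by
      simp only [hsum]
      exact hcont.continuousOn.integrableOn_compact isCompact_Icc)
  simp only [hsum] at this
  rw [this]
  refine Finset.sum_eq_zero fun j _ => sub_eq_zero.2 ?_
  congr 1
  funext x
  have hface : j.insertNth (1 : ℝ) x
      = j.insertNth (0 : ℝ) x + fun k => ((Pi.single j 1 : Fin (n + 1) → ℤ) k : ℝ) := by
    funext k
    refine Fin.succAboveCases j ?_ (fun k => ?_) k <;> simp
  simp only [Pi.one_apply, Pi.zero_apply]
  rw [hface, hper]

lemma integrableOn_unitCube_of_continuous {E : Type*} [NormedAddCommGroup E]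
    {f : (Fin d → ℝ) → E} (hf : Continuous f) : IntegrableOn f (unitCube d) :=
  (hf.continuousOn.integrableOn_compact isCompact_Icc).congr_set_ae unitCube_ae_eq_Icc

end MeanGradient

section PeriodicGradient

variable {d : ℕ}

lemma fderiv_apply_eq_dotProduct_grad (ψ : (Fin d → ℝ) → ℝ) (y v : Fin d → ℝ) :
    fderiv ℝ ψ y v = v ⬝ᵥ grad ψ y := by
  conv_lhs => rw [← Finset.univ_sum_single v]
  rw [map_sum, dotProduct]
  refine Finset.sum_congr rfl fun i _ => ?_
  have : (Pi.single i (v i) : Fin d → ℝ) = v i • Pi.single i 1 := by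
    rw [← Pi.single_smul, smul_eq_mul, mul_one]
  rw [this, map_smul, smul_eq_mul, grad]

lemma continuous_grad {ψ : (Fin d → ℝ) → ℝ} (hψ : ContDiff ℝ 1 ψ) : Continuous (grad ψ) :=
  continuous_pi fun _ => (hψ.continuous_fderiv one_ne_zero).clm_apply continuous_const

/-- A `C¹` function with periodic gradient is the sum of a linear form and a periodic function. -/
lemma exists_eq_dotProduct_add_periodic {ψ : (Fin d → ℝ) → ℝ} (hψ : ContDiff ℝ 1 ψ)
    (hper : ZdPeriodic (fun y => grad ψ y)) :
    ∃ (ξ : Fin d → ℝ) (φ : (Fin d → ℝ) → ℝ), ContDiff ℝ 1 φ ∧ ZdPeriodic φ ∧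
      ∀ y, grad ψ y = ξ + grad φ y := by
  have hdiff := hψ.differentiable one_ne_zero
  have hfd : ZdPeriodic (fderiv ℝ ψ) := fun κ x => by
    ext1 v
    rw [fderiv_apply_eq_dotProduct_grad, fderiv_apply_eq_dotProduct_grad]
    exact congrArg _ (hper κ x)
  have hadd : ∀ κ : Fin d → ℤ, Differentiable ℝ fun x => ψ (x + fun i => (κ i : ℝ)) :=
    fun κ => hdiff.comp (differentiable_id.add_const _)
  have hshift : ∀ (κ : Fin d → ℤ) (x : Fin d → ℝ),
      ψ (x + fun i => (κ i : ℝ)) = ψ x + (ψ (fun i => (κ i : ℝ)) - ψ 0) := by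
    intro κ x
    have := is_const_of_fderiv_eq_zero (𝕜 := ℝ)
      (f := fun x => ψ (x + fun i => (κ i : ℝ)) - ψ x)
      ((hadd κ).sub hdiff) (fun y => by
        rw [fderiv_fun_sub (hadd κ y) (hdiff y),
          fderiv_comp_add_right, hfd κ y, sub_self]) x 0
    simp only [zero_add] at this
    linarith
  let c : (Fin d → ℤ) →+ ℝ :=
    { toFun := fun κ => ψ (fun i => (κ i : ℝ)) - ψ 0
      map_zero' := by
        have : (fun i => ((0 : Fin d → ℤ) i : ℝ)) = 0 := by funext i; simp
        rw [this, sub_self]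
      map_add' := fun κ ν => by
        have : (fun i => ((κ + ν) i : ℝ)) = (fun i => (κ i : ℝ)) + fun i => (ν i : ℝ) := by
          funext i; simp
        rw [this, hshift ν]
        ring }
  let ξ : Fin d → ℝ := fun i => c (fun j => if i = j then 1 else 0)
  have hc : ∀ κ : Fin d → ℤ, c κ = (fun i => (κ i : ℝ)) ⬝ᵥ ξ := fun κ => by
    have := c.toIntLinearMap.pi_apply_eq_sum_univ κ
    simpa [dotProduct, ξ] using this
  obtain ⟨ℓ, hℓ⟩ : ∃ ℓ : (Fin d → ℝ) →L[ℝ] ℝ, ∀ y, ℓ y = y ⬝ᵥ ξ :=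
    ⟨LinearMap.toContinuousLinearMap
      { toFun := fun y => y ⬝ᵥ ξ
        map_add' := fun x y => add_dotProduct x y ξ
        map_smul' := fun a x => smul_dotProduct a x ξ }, fun _ => rfl⟩
  refine ⟨ξ, fun y => ψ y - ℓ y, hψ.sub ℓ.contDiff, fun κ x => ?_, fun y => ?_⟩
  · have : ψ (x + fun i => (κ i : ℝ)) = ψ x + c κ := hshift κ x
    beta_reduce
    rw [this, hc, map_add, hℓ (fun i => (κ i : ℝ))]
    ring
  · funext i
    simp only [grad, Pi.add_apply]
    rw [fderiv_fun_sub (hdiff y) ℓ.differentiableAt, ContinuousLinearMap.fderiv]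
    simp [hℓ]

end PeriodicGradient

section Mollification

open scoped Convolution

variable {d : ℕ} (ρ : ContDiffBump (0 : Fin d → ℝ))

/-- Convolution of `u` with the normalized bump `ρ`. -/
def mollify (u : (Fin d → ℝ) → ℝ) : (Fin d → ℝ) → ℝ :=
  ρ.normed volume ⋆[ContinuousLinearMap.lsmul ℝ ℝ, volume] u

lemma mollify_apply (u : (Fin d → ℝ) → ℝ) (x : Fin d → ℝ) :
    mollify ρ u x = ∫ z, ρ.normed volume z * u (x - z) := rfl

lemma contDiff_mollify {u : (Fin d → ℝ) → ℝ} (hu : Continuous u) :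
    ContDiff ℝ 1 (mollify ρ u) :=
  ρ.hasCompactSupport_normed.contDiff_convolution_left (n := 1) _ ρ.contDiff_normed
    hu.locallyIntegrable

lemma ZdPeriodic.mollify {u : (Fin d → ℝ) → ℝ} (hu : ZdPeriodic u) :
    ZdPeriodic (mollify ρ u) := fun κ x => by
  simp only [mollify_apply, add_sub_right_comm _ _ _, hu κ]

lemma abs_mollify_sub_le {u : (Fin d → ℝ) → ℝ} (hu : Continuous u) {x : Fin d → ℝ} {ε c : ℝ}
    (hε : 0 ≤ ε) (h : ∀ w ∈ Metric.ball x ρ.rOut, |u w - c| ≤ ε) : |mollify ρ u x - c| ≤ ε :=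
  dist_convolution_le hε ρ.support_normed_eq.subset (fun _ => ρ.nonneg_normed _)
    ρ.integral_normed hu.aestronglyMeasurable h

lemma integrable_normed_mul {u : (Fin d → ℝ) → ℝ} (hu : Continuous u) (x : Fin d → ℝ) :
    Integrable fun z => ρ.normed volume z * u (x - z) :=
  Continuous.integrable_of_hasCompactSupport
    (ρ.continuous_normed.mul (hu.comp (continuous_const.sub continuous_id)))
    ρ.hasCompactSupport_normed.mul_right

lemma mollify_sub {u v : (Fin d → ℝ) → ℝ} (hu : Continuous u) (hv : Continuous v)
    (x : Fin d → ℝ) : mollify ρ (fun w => u w - v w) x = mollify ρ u x - mollify ρ v x := by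
  simp only [mollify_apply, mul_sub]
  exact integral_sub (integrable_normed_mul ρ hu x) (integrable_normed_mul ρ hv x)

variable {b : (Fin d → ℝ) → (Fin d → ℝ)} {X : ℝ → (Fin d → ℝ) → (Fin d → ℝ)}
  {K L : NNReal} {u g : (Fin d → ℝ) → ℝ}

lemma hasDerivAt_mollify_comp_flow (hb : LipschitzWith K b) (hX : IsFlowOf b X)
    (hu : Continuous u) (hg : Continuous g) (hgper : ZdPeriodic g)
    (hder : ∀ s x, HasDerivAt (fun s => u (X s x)) (g (X s x)) s) (x : Fin d → ℝ) :
    HasDerivAt (fun h => mollify ρ (fun w => u (X h w)) x) (mollify ρ g x) 0 := by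
  obtain ⟨C, -, hC⟩ := hgper.exists_norm_le hg
  have hXc := hX.continuous hb
  have h := (hasDerivAt_integral_of_dominated_loc_of_deriv_le (μ := (volume : Measure (Fin d → ℝ)))
    (s := Set.univ) (x₀ := (0 : ℝ)) (bound := fun z => ρ.normed volume z * C)
    (F := fun h z => ρ.normed volume z * u (X h (x - z)))
    (F' := fun h z => ρ.normed volume z * g (X h (x - z)))
    univ_mem
    (Eventually.of_forall fun h =>
      (integrable_normed_mul ρ (hu.comp (hXc h)) x).aestronglyMeasurable)
    (integrable_normed_mul ρ (hu.comp (hXc 0)) x)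
    (integrable_normed_mul ρ (hg.comp (hXc 0)) x).aestronglyMeasurable
    (Eventually.of_forall fun z h _ => by
      rw [norm_mul, Real.norm_of_nonneg (ρ.nonneg_normed z)]
      exact mul_le_mul_of_nonneg_left (hC _) (ρ.nonneg_normed z))
    (ρ.integrable_normed.mul_const C)
    (Eventually.of_forall fun z h _ => (hder h (x - z)).const_mul _)).2
  simpa only [mollify_apply, hX.zero] using h

/-- Friedrichs' commutator estimate: mollification almost commutes with differentiation along
the flow. -/
lemma abs_fderiv_mollify_sub_le (hb : LipschitzWith K b) (hbper : ZdPeriodic b)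
    (hX : IsFlowOf b X) (hu : LipschitzWith L u) (hg : Continuous g) (hgper : ZdPeriodic g)
    (hder : ∀ s x, HasDerivAt (fun s => u (X s x)) (g (X s x)) s) (x : Fin d → ℝ) :
    |fderiv ℝ (mollify ρ u) x (b x) - mollify ρ g x| ≤ L * (K * (2 * ρ.rOut)) := by
  obtain ⟨B, hB0, hB⟩ := hbper.exists_norm_le hb.continuous
  have hline : HasDerivAt (fun h : ℝ => x + h • b x) (b x) 0 := by
    simpa using ((hasDerivAt_id (0 : ℝ)).smul_const (b x)).const_add x
  have hv : HasFDerivAt (mollify ρ u) (fderiv ℝ (mollify ρ u) x) (x + (0 : ℝ) • b x) := by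
    simpa using ((contDiff_mollify ρ hu.continuous).differentiable one_ne_zero x).hasFDerivAt
  have hD := (hv.comp_hasDerivAt (0 : ℝ) hline).sub
    (hasDerivAt_mollify_comp_flow ρ hb hX hu.continuous hg hgper hder x)
  have hr := ρ.rOut_pos
  refine hD.le_of_lip' (by positivity) ?_
  have hsmall : ∀ᶠ h : ℝ in nhds 0, B * |h| < ρ.rOut :=
    (continuous_const.mul continuous_abs).continuousAt.eventually_lt continuousAt_const
      (by simpa using hr)
  filter_upwards [hsmall] with h hh
  have hc1 : Continuous fun w => u (w + h • b x) :=
    hu.continuous.comp (continuous_id.add continuous_const)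
  have hc2 : Continuous fun w => u (X h w) := hu.continuous.comp (hX.continuous hb h)
  have key : mollify ρ u (x + h • b x) - mollify ρ (fun w => u (X h w)) x
      = mollify ρ (fun w => u (w + h • b x) - u (X h w)) x := by
    rw [mollify_sub ρ hc1 hc2]
    simp only [mollify_apply, add_sub_right_comm _ _ _]
  have hzero : mollify ρ u (x + (0 : ℝ) • b x) - mollify ρ (fun w => u (X 0 w)) x = 0 := by
    simp [hX.zero]
  simp only [Pi.sub_apply, Function.comp_apply]
  rw [hzero, key]
  refine abs_mollify_sub_le ρ (hc1.sub hc2) (by positivity) fun w hw => ?_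
  rw [sub_zero, sub_zero]
  have hdev := hX.norm_sub_le hb hB (Metric.mem_ball.1 hw).le h
  calc |u (w + h • b x) - u (X h w)| ≤ L * ‖w + h • b x - X h w‖ := by
        rw [← dist_eq_norm, ← Real.dist_eq]
        exact hu.dist_le_mul _ _
    _ ≤ L * (K * (ρ.rOut + B * |h|) * |h|) := by gcongr
    _ ≤ L * (K * (2 * ρ.rOut) * |h|) := by
        gcongr
        linarith
    _ = L * (K * (2 * ρ.rOut)) * ‖h‖ := by
        rw [Real.norm_eq_abs]
        ring

/-- A bump at the origin with prescribed outer radius. -/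
lemma exists_bump_rOut_eq {δ : ℝ} (hδ : 0 < δ) : ∃ ρ : ContDiffBump (0 : Fin d → ℝ), ρ.rOut = δ :=
  ⟨⟨δ / 2, δ, half_pos hδ, half_lt_self hδ⟩, rfl⟩

/-- If the derivatives along `b` of all periodic `C¹` functions have zero `μ`-mean, the same holds
for Lipschitz functions that are differentiable along the flow. -/
lemma integral_flow_deriv_eq_zero {μ : Measure (Fin d → ℝ)} [IsProbabilityMeasure μ]
    (hμ : ∀ φ : (Fin d → ℝ) → ℝ, ContDiff ℝ 1 φ → ZdPeriodic φ → ∫ y, fderiv ℝ φ y (b y) ∂μ = 0)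
    (hb : LipschitzWith K b) (hbper : ZdPeriodic b) (hX : IsFlowOf b X) (hu : LipschitzWith L u)
    (huper : ZdPeriodic u) (hg : Continuous g) (hgper : ZdPeriodic g)
    (hder : ∀ s x, HasDerivAt (fun s => u (X s x)) (g (X s x)) s) :
    ∫ y, g y ∂μ = 0 := by
  rw [← abs_nonpos_iff]
  refine le_of_forall_pos_le_add fun ε hε => ?_
  obtain ⟨δ, hδ, hgδ⟩ := Metric.uniformContinuous_iff.1 (hgper.uniformContinuous hg) (ε / 2)
    (half_pos hε)
  have hM : (0 : ℝ) < 4 * (L * K + 1) := by positivity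
  obtain ⟨ρ, hρ⟩ := exists_bump_rOut_eq (d := d) (lt_min hδ (div_pos hε hM))
  have hρδ : ρ.rOut ≤ δ := hρ.trans_le (min_le_left _ _)
  have hρε : ρ.rOut * (4 * (L * K + 1)) ≤ ε :=
    (le_div_iff₀ hM).1 (hρ.trans_le (min_le_right _ _))
  have hv := contDiff_mollify ρ hu.continuous
  have hvper := huper.mollify ρ
  have hbound : ∀ y, ‖g y - fderiv ℝ (mollify ρ u) y (b y)‖ ≤ ε := fun y => by
    have h1 := abs_fderiv_mollify_sub_le ρ hb hbper hX hu hg hgper hder y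
    have h2 : |mollify ρ g y - g y| ≤ ε / 2 :=
      abs_mollify_sub_le ρ hg (half_pos hε).le fun w hw =>
        (hgδ ((Metric.mem_ball.1 hw).trans_le hρδ)).le
    have h3 : L * (K * (2 * ρ.rOut)) ≤ ε / 2 := by nlinarith [ρ.rOut_pos]
    rw [Real.norm_eq_abs, abs_sub_comm]
    calc _ ≤ |fderiv ℝ (mollify ρ u) y (b y) - mollify ρ g y| + |mollify ρ g y - g y| :=
          abs_sub_le _ _ _
      _ ≤ ε := by linarith
  have hint : ∫ y, g y ∂μ = ∫ y, (g y - fderiv ℝ (mollify ρ u) y (b y)) ∂μ := by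
    rw [integral_sub (hgper.integrable hg μ) ((hvper.fderiv_apply hbper).integrable
      ((hv.continuous_fderiv one_ne_zero).clm_apply hb.continuous) μ), hμ _ hv hvper, sub_zero]
  rw [hint, zero_add]
  simpa using norm_integral_le_of_norm_le_const (μ := μ) (Eventually.of_forall hbound)

end Mollification

section Invariance

variable {d : ℕ} {b : (Fin d → ℝ) → (Fin d → ℝ)} {X : ℝ → (Fin d → ℝ) → (Fin d → ℝ)}
  {K : NNReal} {μ : Measure (Fin d → ℝ)} {φ : (Fin d → ℝ) → ℝ}

lemma IsFlowOf.hasDerivAt_comp (hX : IsFlowOf b X) (hφ : ContDiff ℝ 1 φ) (s : ℝ)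
    (x : Fin d → ℝ) :
    HasDerivAt (fun s => φ (X s x)) (fderiv ℝ φ (X s x) (b (X s x))) s :=
  ((hφ.differentiable one_ne_zero) (X s x)).hasFDerivAt.comp_hasDerivAt s (hX.hasDerivAt x s)

lemma hasDerivAt_integral_comp_flow [IsProbabilityMeasure μ] (hb : LipschitzWith K b)
    (hbper : ZdPeriodic b) (hX : IsFlowOf b X) (hφ : ContDiff ℝ 1 φ) (hper : ZdPeriodic φ)
    (t : ℝ) :
    HasDerivAt (fun t => ∫ y, φ (X t y) ∂μ) (∫ y, fderiv ℝ φ (X t y) (b (X t y)) ∂μ) t := by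
  have hG : Continuous fun y => fderiv ℝ φ y (b y) :=
    (hφ.continuous_fderiv one_ne_zero).clm_apply hb.continuous
  obtain ⟨C, -, hC⟩ := (hper.fderiv_apply hbper).exists_norm_le hG
  have hint : ∀ t, Integrable (fun y => φ (X t y)) μ := fun t =>
    (hper.comp_flow hb hbper hX t).integrable (hφ.continuous.comp (hX.continuous hb t)) μ
  exact (hasDerivAt_integral_of_dominated_loc_of_deriv_le (s := Set.univ) (bound := fun _ => C)
    (F' := fun t y => fderiv ℝ φ (X t y) (b (X t y))) univ_mem
    (Eventually.of_forall fun t => (hint t).aestronglyMeasurable) (hint t)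
    (hG.comp (hX.continuous hb t)).aestronglyMeasurable
    (Eventually.of_forall fun y t _ => hC _) (integrable_const C)
    (Eventually.of_forall fun y t _ => hX.hasDerivAt_comp hφ t y)).2

lemma FlowInvariant.integral_fderiv_eq_zero [IsProbabilityMeasure μ] (hinv : FlowInvariant X μ)
    (hb : LipschitzWith K b) (hbper : ZdPeriodic b) (hX : IsFlowOf b X) (hφ : ContDiff ℝ 1 φ)
    (hper : ZdPeriodic φ) : ∫ y, fderiv ℝ φ y (b y) ∂μ = 0 := by
  have h := hasDerivAt_integral_comp_flow (μ := μ) hb hbper hX hφ hper 0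
  simp only [hX.zero, hinv _ φ hφ.continuous hper] at h
  exact h.unique (hasDerivAt_const _ _)

lemma flowInvariant_of_integral_fderiv_eq_zero [IsProbabilityMeasure μ]
    (hμ : ∀ φ : (Fin d → ℝ) → ℝ, ContDiff ℝ 1 φ → ZdPeriodic φ → ∫ y, fderiv ℝ φ y (b y) ∂μ = 0)
    (hb : LipschitzWith K b) (hbper : ZdPeriodic b) (hX : IsFlowOf b X) : FlowInvariant X μ := by
  have smooth : ∀ φ : (Fin d → ℝ) → ℝ, ContDiff ℝ 1 φ → ZdPeriodic φ → ∀ t,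
      ∫ y, φ (X t y) ∂μ = ∫ y, φ y ∂μ := by
    intro φ hφ hper t
    have hd := hasDerivAt_integral_comp_flow (μ := μ) hb hbper hX hφ hper
    have hzero : ∀ t, ∫ y, fderiv ℝ φ (X t y) (b (X t y)) ∂μ = 0 := fun t => by
      obtain ⟨L, hL⟩ := hper.exists_lipschitzWith hφ
      obtain ⟨M, hM⟩ := hX.exists_lipschitzWith hb t
      refine integral_flow_deriv_eq_zero hμ hb hbper hX (hL.comp hM)
        (hper.comp_flow hb hbper hX t)
        (((hφ.continuous_fderiv one_ne_zero).clm_apply hb.continuous).comp (hX.continuous hb t))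
        ((hper.fderiv_apply hbper).comp_flow hb hbper hX t) fun s x => ?_
      simp only [Function.comp_apply, ← hX.add hb]
      exact (hX.hasDerivAt_comp hφ (t + s) x).comp_const_add t s
    have := is_const_of_deriv_eq_zero (fun t => (hd t).differentiableAt)
      (fun t => (hd t).deriv.trans (hzero t)) t 0
    simpa only [hX.zero] using this
  intro t ψ hψ hper
  refine eq_of_forall_dist_le fun ε hε => ?_
  obtain ⟨δ, hδ, hψδ⟩ := Metric.uniformContinuous_iff.1 (hper.uniformContinuous hψ) (ε / 2)
    (half_pos hε)
  obtain ⟨ρ, hρ⟩ := exists_bump_rOut_eq (d := d) hδ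
  have hv := contDiff_mollify ρ hψ
  have hvper := hper.mollify ρ
  have hclose : ∀ y, ‖mollify ρ ψ y - ψ y‖ ≤ ε / 2 := fun y =>
    abs_mollify_sub_le ρ hψ (half_pos hε).le fun w hw =>
      (hψδ ((Metric.mem_ball.1 hw).trans_eq hρ)).le
  have hdist : ∀ s, dist (∫ y, mollify ρ ψ (X s y) ∂μ) (∫ y, ψ (X s y) ∂μ) ≤ ε / 2 := fun s => by
    rw [dist_eq_norm, ← integral_sub
      ((hvper.comp_flow hb hbper hX s).integrable (hv.continuous.comp (hX.continuous hb s)) μ)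
      ((hper.comp_flow hb hbper hX s).integrable (hψ.comp (hX.continuous hb s)) μ)]
    simpa using norm_integral_le_of_norm_le_const (μ := μ)
      (Eventually.of_forall fun y => hclose (X s y))
  have h0 := hdist 0
  simp only [hX.zero] at h0
  have ht := hdist t
  rw [smooth _ hv hvper, dist_comm] at ht
  linarith [dist_triangle (∫ y, ψ (X t y) ∂μ) (∫ y, mollify ρ ψ y ∂μ) (∫ y, ψ y ∂μ)]

lemma ZdPeriodic.setIntegral_grad_eq_zero (hper : ZdPeriodic φ) (hφ : ContDiff ℝ 1 φ) :
    ∫ y in unitCube d, grad φ y = 0 := by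
  funext i
  rw [eval_integral fun j => (integrableOn_unitCube_of_continuous (continuous_grad hφ)).eval j]
  exact hper.setIntegral_fderiv_single_eq_zero hφ i

lemma integral_dotProduct_const {f : (Fin d → ℝ) → (Fin d → ℝ)} (hf : Integrable f μ)
    (ξ : Fin d → ℝ) : ∫ y, f y ⬝ᵥ ξ ∂μ = (∫ y, f y ∂μ) ⬝ᵥ ξ := by
  simp only [dotProduct, eval_integral hf.eval]
  rw [integral_finsetSum _ fun i _ => (hf.eval i).mul_const _]
  simp only [integral_mul_const]

end Invariance

/-- For `b ∈ C¹_♯(Y_d)^d` with flow `X` and a probability measure `μ` on `Y_d`,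
`μ` is invariant for the flow `X` iff the divergence-curl identity holds: for every `C¹`
function `ψ : ℝ^d → ℝ` whose gradient `∇ψ` is `ℤ^d`-periodic (and continuous),
`∫_{Y_d} b·∇ψ dμ = (∫_{Y_d} b dμ)·(∫_{Y_d} ∇ψ dy)`. -/
theorem flowInvariant_iff_divergence_curl {d : ℕ} (hd : 1 ≤ d)
    (b : (Fin d → ℝ) → (Fin d → ℝ)) (hb : ContDiff ℝ 1 b) (hbper : ZdPeriodic b)
    (X : ℝ → (Fin d → ℝ) → (Fin d → ℝ)) (hX : IsFlowOf b X)
    (μ : Measure (Fin d → ℝ)) (hμ : IsProbabilityMeasure μ) (hμc : μ (unitCube d)ᶜ = 0) :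
    FlowInvariant X μ ↔
      ∀ ψ : (Fin d → ℝ) → ℝ, ContDiff ℝ 1 ψ → ZdPeriodic (fun y => grad ψ y) →
        ∫ y, fderiv ℝ ψ y (b y) ∂μ =
          (∫ y, b y ∂μ) ⬝ᵥ (∫ y in unitCube d, grad ψ y) := by
  obtain ⟨K, hK⟩ := hbper.exists_lipschitzWith hb
  constructor
  · intro hinv ψ hψ hper
    obtain ⟨ξ, φ, hφ, hφper, hgrad⟩ := exists_eq_dotProduct_add_periodic hψ hper
    have hmean : ∫ y in unitCube d, grad ψ y = ξ := by
      simp only [hgrad]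
      rw [integral_add (integrableOn_unitCube_of_continuous continuous_const)
        (integrableOn_unitCube_of_continuous (continuous_grad hφ)),
        hφper.setIntegral_grad_eq_zero hφ, add_zero, setIntegral_const, Measure.real,
        volume_unitCube, ENNReal.toReal_one, one_smul]
    have hsplit : ∀ y, fderiv ℝ ψ y (b y) = b y ⬝ᵥ ξ + fderiv ℝ φ y (b y) := fun y => by
      rw [fderiv_apply_eq_dotProduct_grad ψ, hgrad, dotProduct_add,
        ← fderiv_apply_eq_dotProduct_grad φ]
    have hint := hbper.integrable hb.continuous μ
    simp only [hsplit]
    rw [hmean, integral_add ((hbper.comp fun v => v ⬝ᵥ ξ).integrable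
        (hb.continuous.dotProduct continuous_const) μ)
      ((hφper.fderiv_apply hbper).integrable
        ((hφ.continuous_fderiv one_ne_zero).clm_apply hb.continuous) μ),
      hinv.integral_fderiv_eq_zero hK hbper hX hφ hφper, add_zero,
      integral_dotProduct_const hint]
  · intro h
    refine flowInvariant_of_integral_fderiv_eq_zero (fun φ hφ hper => ?_) hK hbper hX
    rw [h φ hφ fun κ x => ?_, hper.setIntegral_grad_eq_zero hφ, dotProduct_zero]
    funext i
    exact congrArg (fun T => T (Pi.single i 1)) (hper.fderiv κ x)
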